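/- Let R be an integral domain, * a star operation on R, and I a nonzero ideal of R. Then I is strongly *-stable if and only if I is both Boole *-regular and *-stable. Consequently, every nonzero ideal of R is strongly *-stable if and only if R is Boole *-regular and every nonzero ideal of R is *-stable. -/

import Mathlib

open scoped Pointwise

section Defs

variable (A K : Type*) [CommRing A] [Field K] [Algebra A K]

/-- `I` is a nonzero fractional ideal of `A` (inside `K`):
`I ≠ 0` and `dI ⊆ A` for some nonzero `d ∈ A`. -/
def IsFrac (I : Submodule A K) : Prop :=
  I ≠ ⊥ ∧ ∃ d : A, d ≠ 0 ∧ ∀ x ∈ I, ∃ a : A, algebraMap A K d * x = algebraMap A K a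

/-- The divisorial closure `I^v = (A : (A : I))`; here `(J : I) = J / I` and
`(1 : Submodule A K)` is the image of `A` in `K`. -/
def vS (I : Submodule A K) : Submodule A K := 1 / (1 / I)

/-- The `t`-operation `I^t = ⋃ {J^v : J ⊆ I nonzero finitely generated}` (a directed union,
hence equal to the supremum of submodules). -/
def tS (I : Submodule A K) : Submodule A K :=
  ⨆ J ∈ {J : Submodule A K | J ≠ ⊥ ∧ J.FG ∧ J ≤ I}, vS A K J

/-- The image of an integral ideal of `A` in `K`. -/
def idealK (I : Ideal A) : Submodule A K := Submodule.map (Algebra.linearMap A K) I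

/-- A nonzero (fractional) ideal `I` is stable if `I((I:I):I) = (I:I)`. -/
def IsStableIdeal (I : Submodule A K) : Prop := I * ((I / I) / I) = I / I

/-- `A` is a stable domain: every nonzero (fractional) ideal is stable. -/
def StableDomain : Prop := ∀ I : Submodule A K, IsFrac A K I → IsStableIdeal A K I

/-- `A` is Clifford regular: every nonzero (fractional) ideal `I` satisfies `I = I²J`
for some nonzero `A`-submodule `J` of `K`. -/
def CliffordRegularDomain : Prop :=
  ∀ I : Submodule A K, IsFrac A K I → ∃ J : Submodule A K, J ≠ ⊥ ∧ I = I * I * J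

end Defs
section Star

variable (R K : Type*) [CommRing R] [IsDomain R] [Field K] [Algebra R K] [IsFractionRing R K]

/-- A star operation on the domain `R` with quotient field `K`: a map on (nonzero)
fractional ideals satisfying `(aI)^* = aI^*`, `R^* = R`, `I ⊆ I^*`, monotonicity and
idempotency. -/
structure StarOperation : Type _ where
  star : Submodule R K → Submodule R K
  star_frac : ∀ I, IsFrac R K I → IsFrac R K (star I)
  star_smul : ∀ (a : K), a ≠ 0 → ∀ I, IsFrac R K I → star (a • I) = a • star I
  star_one : star (1 : Submodule R K) = 1
  le_star : ∀ I, IsFrac R K I → I ≤ star I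
  star_mono : ∀ I J, IsFrac R K I → IsFrac R K J → I ≤ J → star I ≤ star J
  star_star : ∀ I, IsFrac R K I → star (star I) = star I

variable {R K}

/-- `*` is of finite type: `I^* = ⋃ {J^* : J ⊆ I nonzero finitely generated}`. -/
def StarOperation.FiniteType (s : StarOperation R K) : Prop :=
  ∀ I, IsFrac R K I →
    s.star I = ⨆ J ∈ {J : Submodule R K | J ≠ ⊥ ∧ J.FG ∧ J ≤ I}, s.star J

/-- `I` is `*`-stable: with `E := (I^* : I^*)`, one has `(I^*(E : I^*))^* = E`. -/
def StarOperation.Stable (s : StarOperation R K) (I : Submodule R K) : Prop :=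
  s.star (s.star I * ((s.star I / s.star I) / s.star I)) = s.star I / s.star I

/-- `I` is Clifford `*`-regular: `I^* = (I²J)^*` for some nonzero ideal `J`. -/
def StarOperation.Regular (s : StarOperation R K) (I : Submodule R K) : Prop :=
  ∃ J : Submodule R K, IsFrac R K J ∧ s.star I = s.star (I * I * J)

/-- `I` is Boole `*`-regular: `(I²)^* = xI^*` for some nonzero `x ∈ K`. -/
def StarOperation.BooleRegular (s : StarOperation R K) (I : Submodule R K) : Prop :=
  ∃ x : K, x ≠ 0 ∧ s.star (I * I) = x • s.star I

/-- `I` is strongly `*`-stable: `I^* = xE` for some nonzero `x ∈ K`, where `E = (I^* : I^*)`. -/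
def StarOperation.StronglyStable (s : StarOperation R K) (I : Submodule R K) : Prop :=
  ∃ x : K, x ≠ 0 ∧ s.star I = x • (s.star I / s.star I)

end Star

section Lemmas

variable {R K : Type*} [CommRing R] [Field K] [Algebra R K]

theorem pointwise_smul_eq_span_mul (x : K) (I : Submodule R K) :
    x • I = Submodule.span R {x} * I := by
  ext y
  rw [Submodule.mem_span_singleton_mul, Submodule.mem_smul_pointwise_iff_exists]
  rfl

theorem pointwise_smul_mul (x : K) (I J : Submodule R K) : (x • I) * J = x • (I * J) := by
  simp only [pointwise_smul_eq_span_mul, mul_assoc]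

theorem Submodule.div_self_mul_self (I : Submodule R K) : (I / I) * I = I := by
  refine le_antisymm (Submodule.le_div_iff_mul_le.mp le_rfl) fun x hx => ?_
  have h : (1 : K) ∈ I / I := by
    rw [Submodule.mem_div_iff_forall_mul_mem]
    intro y hy
    rwa [one_mul]
  simpa using Submodule.mul_mem_mul h hx

theorem IsFrac.exists_ne_zero {I : Submodule R K} (hI : IsFrac R K I) : ∃ x ∈ I, x ≠ 0 :=
  Submodule.exists_mem_ne_zero_of_ne_bot hI.1

theorem IsFrac.mono {I J : Submodule R K} (hJ : IsFrac R K J) (hI : I ≠ ⊥) (h : I ≤ J) :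
    IsFrac R K I :=
  ⟨hI, hJ.2.imp fun _ hd => ⟨hd.1, fun x hx => hd.2 x (h hx)⟩⟩

theorem StarOperation.StronglyStable.stable {s : StarOperation R K} {I : Submodule R K}
    (hI : IsFrac R K I) (h : s.StronglyStable I) : s.Stable I := by
  obtain ⟨x, hx, hxI⟩ := h
  have hL := s.star_frac I hI
  unfold StarOperation.Stable
  have hstar : s.star (s.star I / s.star I) = s.star I / s.star I := by
    have hE : s.star I / s.star I = x⁻¹ • s.star I := ((inv_smul_eq_iff₀ hx).mpr hxI).symm
    rw [hE, s.star_smul _ (inv_ne_zero hx) _ hL, s.star_star I hI]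
  have hmul : s.star I * ((s.star I / s.star I) / s.star I) = s.star I / s.star I := by
    refine le_antisymm ?_ fun z hz => ?_
    · rw [mul_comm]
      exact Submodule.le_div_iff_mul_le.mp le_rfl
    have hxL : x ∈ s.star I := by
      rw [hxI, Submodule.mem_smul_pointwise_iff_exists]
      refine ⟨1, Submodule.mem_div_iff_forall_mul_mem.mpr fun y hy => ?_, mul_one x⟩
      rwa [one_mul]
    have hxz : x⁻¹ * z ∈ (s.star I / s.star I) / s.star I := by
      rw [Submodule.mem_div_iff_forall_mul_mem]
      intro y hy
      rw [hxI, Submodule.mem_smul_pointwise_iff_exists] at hy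
      obtain ⟨f, hf, rfl⟩ := hy
      rw [Submodule.mem_div_iff_forall_mul_mem] at hz hf ⊢
      intro w hw
      have heq : x⁻¹ * z * x • f * w = z * (f * w) := by
        rw [smul_eq_mul]
        field_simp
      rw [heq]
      exact hz _ (hf w hw)
    simpa [hx] using Submodule.mul_mem_mul hxL hxz
  rw [hmul, hstar]

variable [IsDomain R]

theorem IsFrac.mul {I J : Submodule R K} (hI : IsFrac R K I) (hJ : IsFrac R K J) :
    IsFrac R K (I * J) := by
  obtain ⟨x, hx, hx0⟩ := hI.exists_ne_zero
  obtain ⟨y, hy, hy0⟩ := hJ.exists_ne_zero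
  obtain ⟨-, d, hd, hdI⟩ := hI
  obtain ⟨-, e, he, heJ⟩ := hJ
  refine ⟨(Submodule.ne_bot_iff _).mpr
    ⟨x * y, Submodule.mul_mem_mul hx hy, mul_ne_zero hx0 hy0⟩, d * e, mul_ne_zero hd he, ?_⟩
  intro z hz
  induction hz using Submodule.mul_induction_on' with
  | mem_mul_mem m hm n hn =>
    obtain ⟨a, ha⟩ := hdI m hm
    obtain ⟨b, hb⟩ := heJ n hn
    exact ⟨a * b, by rw [map_mul, map_mul, ← ha, ← hb]; ring⟩
  | add u _ v _ hu hv =>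
    obtain ⟨a, ha⟩ := hu
    obtain ⟨b, hb⟩ := hv
    exact ⟨a + b, by rw [map_add, ← ha, ← hb]; ring⟩

variable [IsFractionRing R K]

theorem IsFrac.smul {I : Submodule R K} (hI : IsFrac R K I) {x : K} (hx : x ≠ 0) :
    IsFrac R K (x • I) := by
  rw [pointwise_smul_eq_span_mul]
  refine IsFrac.mul ⟨by simpa using hx, ?_⟩ hI
  obtain ⟨a, d, hd, rfl⟩ := IsFractionRing.div_surjective (A := R) x
  have hd0 : algebraMap R K d ≠ 0 := IsFractionRing.to_map_ne_zero_of_mem_nonZeroDivisors hd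
  refine ⟨d, nonZeroDivisors.ne_zero hd, fun y hy => ?_⟩
  obtain ⟨r, rfl⟩ := Submodule.mem_span_singleton.mp hy
  refine ⟨r * a, ?_⟩
  rw [Algebra.smul_def, map_mul]
  field_simp

theorem IsFrac.div {I J : Submodule R K} (hI : IsFrac R K I) (hJ : IsFrac R K J) :
    IsFrac R K (I / J) := by
  obtain ⟨x, hx, hx0⟩ := hI.exists_ne_zero
  obtain ⟨y, hy, hy0⟩ := hJ.exists_ne_zero
  refine (hI.smul (inv_ne_zero hy0)).mono ?_ fun z hz => ?_
  · obtain ⟨-, d, hd, hdJ⟩ := hJ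
    have hd0 : algebraMap R K d ≠ 0 :=
      (map_ne_zero_iff _ (IsFractionRing.injective R K)).mpr hd
    refine (Submodule.ne_bot_iff _).mpr ⟨algebraMap R K d * x, ?_, mul_ne_zero hd0 hx0⟩
    rw [Submodule.mem_div_iff_forall_mul_mem]
    intro z hz
    obtain ⟨a, ha⟩ := hdJ z hz
    rw [mul_right_comm, ha, ← Algebra.smul_def]
    exact I.smul_mem a hx
  · rw [Submodule.mem_smul_pointwise_iff_exists]
    refine ⟨z * y, Submodule.mem_div_iff_forall_mul_mem.mp hz y hy, ?_⟩
    rw [smul_eq_mul]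
    field_simp

theorem StarOperation.star_star_mul (s : StarOperation R K) {I J : Submodule R K}
    (hI : IsFrac R K I) (hJ : IsFrac R K J) : s.star (s.star I * J) = s.star (I * J) := by
  have hIJ := hI.mul hJ
  have hsIJ := (s.star_frac I hI).mul hJ
  refine le_antisymm ?_
    (s.star_mono _ _ hIJ hsIJ (mul_le_mul' (s.le_star I hI) le_rfl))
  rw [← s.star_star _ hIJ]
  refine s.star_mono _ _ hsIJ (s.star_frac _ hIJ) (Submodule.mul_le.mpr fun m hm n hn => ?_)
  rcases eq_or_ne n 0 with rfl | hn0
  · rw [mul_zero]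
    exact zero_mem _
  have hle : n • I ≤ I * J := by
    rw [pointwise_smul_eq_span_mul, mul_comm]
    exact mul_le_mul' le_rfl ((Submodule.span_singleton_le_iff_mem _ _).mpr hn)
  apply s.star_mono _ _ (hI.smul hn0) hIJ hle
  rw [s.star_smul n hn0 I hI, mul_comm, ← smul_eq_mul]
  exact Submodule.smul_mem_pointwise_smul m n _ hm

theorem StarOperation.star_mul_star (s : StarOperation R K) {I J : Submodule R K}
    (hI : IsFrac R K I) (hJ : IsFrac R K J) : s.star (I * s.star J) = s.star (I * J) := by
  rw [mul_comm, s.star_star_mul hJ hI, mul_comm]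

theorem StarOperation.StronglyStable.booleRegular {s : StarOperation R K} {I : Submodule R K}
    (hI : IsFrac R K I) (h : s.StronglyStable I) : s.BooleRegular I := by
  obtain ⟨x, hx, hxI⟩ := h
  refine ⟨x, hx, ?_⟩
  have hL := s.star_frac I hI
  have hmul : s.star I * s.star I = x • s.star I := by
    nth_rw 1 [hxI]
    rw [pointwise_smul_mul, Submodule.div_self_mul_self]
  rw [← s.star_star_mul hI hI, ← s.star_mul_star hL hI, hmul, s.star_smul x hx _ hL,
    s.star_star I hI]

theorem StarOperation.BooleRegular.stronglyStable {s : StarOperation R K} {I : Submodule R K}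
    (hI : IsFrac R K I) (hB : s.BooleRegular I) (hS : s.Stable I) : s.StronglyStable I := by
  obtain ⟨x, hx, hxI⟩ := hB
  refine ⟨x, hx, ?_⟩
  have hL := s.star_frac I hI
  have hE := hL.div hL
  have hJ := hE.div hL
  have hLJ := hL.mul hJ
  have hleft : s.star (s.star I * (s.star I * ((s.star I / s.star I) / s.star I))) =
      s.star I := by
    rw [← s.star_mul_star hL hLJ, hS, mul_comm, Submodule.div_self_mul_self, s.star_star I hI]
  have hLL : s.star (s.star I * s.star I) = x • s.star I := by
    rw [s.star_star_mul hI hL, s.star_mul_star hI hI, hxI]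
  rw [← mul_assoc, ← s.star_star_mul (hL.mul hL) hJ, hLL, pointwise_smul_mul,
    s.star_smul x hx _ hLJ, hS] at hleft
  exact hleft.symm

theorem StarOperation.stronglyStable_iff {s : StarOperation R K} {I : Submodule R K}
    (hI : IsFrac R K I) : s.StronglyStable I ↔ s.BooleRegular I ∧ s.Stable I :=
  ⟨fun h => ⟨h.booleRegular hI, h.stable hI⟩, fun h => h.1.stronglyStable hI h.2⟩

end Lemmas

/-- A nonzero (fractional) ideal `I` of `R` is strongly `*`-stable if and
only if it is both Boole `*`-regular and `*`-stable. Consequently, every nonzero ideal of `R`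
is strongly `*`-stable iff `R` is Boole `*`-regular and every nonzero ideal of `R` is
`*`-stable. -/
theorem strongly_star_stable_iff_boole_regular_and_stable
    {R K : Type*} [CommRing R] [IsDomain R] [Field K] [Algebra R K] [IsFractionRing R K]
    (s : StarOperation R K) :
    (∀ I : Submodule R K, IsFrac R K I → (s.StronglyStable I ↔ s.BooleRegular I ∧ s.Stable I)) ∧
      ((∀ I : Submodule R K, IsFrac R K I → s.StronglyStable I) ↔
        ((∀ I : Submodule R K, IsFrac R K I → s.BooleRegular I) ∧
          (∀ I : Submodule R K, IsFrac R K I → s.Stable I))) := by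
  exact ⟨fun I hI => StarOperation.stronglyStable_iff hI,
    fun h => ⟨fun I hI => (h I hI).booleRegular hI, fun I hI => (h I hI).stable hI⟩,
    fun h I hI => (h.1 I hI).stronglyStable hI (h.2 I hI)⟩
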